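/- Define a_0 = 20, a_j = 2^{a_{j−1}} for j ≥ 1, and E_j = (a_j)². Define ℓ_j = 4E_jE_{j−2}/E_{j−1} for j ≥ 2 and L_j = ℓ_j + ∑_{k=1}^{j−1} b_j b_{j−1} ⋯ b_{k+1} ℓ_k with ℓ_1 = E_1 and b_k = E_k/E_{k−1}. Then for every j ≥ 2, ℓ_j / L_j ≤ 4 (a_{j−2}/2^{a_{j−2}})²; in particular ℓ_j/L_j → 0 as j → ∞. -/

import Mathlib

/-- The sequence `a_0 = 20`, `a_j = 2^{a_{j-1}}`. -/
def a : ℕ → ℕ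
  | 0 => 20
  | j + 1 => 2 ^ a j

/-- `E_j = (a_j)²`. -/
def E (j : ℕ) : ℕ := a j ^ 2

/-- `ℓ_1 = E_1` and `ℓ_j = 4 E_j E_{j-2} / E_{j-1}` for `j ≥ 2`, as reals. -/
noncomputable def ell (j : ℕ) : ℝ :=
  if j = 1 then (E 1 : ℝ) else 4 * (E j : ℝ) * (E (j - 2) : ℝ) / (E (j - 1) : ℝ)

/-- `b_j = E_j / E_{j-1}`, as a real. -/
noncomputable def b (j : ℕ) : ℝ := (E j : ℝ) / (E (j - 1) : ℝ)

/-- `L_j = ℓ_j + ∑_{k=1}^{j-1} b_j b_{j-1} ⋯ b_{k+1} ℓ_k` (so `L_1 = ℓ_1`). -/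
noncomputable def Lb (j : ℕ) : ℝ :=
  ell j + ∑ k ∈ Finset.Icc 1 (j - 1), (∏ i ∈ Finset.Icc (k + 1) j, b i) * ell k

lemma a_pos (j : ℕ) : 0 < a j := by
  cases j <;> simp [a]

lemma E_pos (j : ℕ) : (0 : ℝ) < E j := by
  exact_mod_cast pow_pos (a_pos j) 2

lemma strictMono_a : StrictMono a :=
  strictMono_nat_of_lt_succ fun _ => Nat.lt_two_pow_self

lemma ell_pos (j : ℕ) : 0 < ell j := by
  have h₀ := E_pos j
  have h₁ := E_pos (j - 1)
  have h₂ := E_pos (j - 2)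
  have h₃ := E_pos 1
  unfold ell
  split_ifs <;> positivity

lemma b_pos (j : ℕ) : 0 < b j :=
  div_pos (E_pos j) (E_pos (j - 1))

/-- The product `b_2 ⋯ b_j` telescopes. -/
lemma prod_b_mul_E_one (n : ℕ) :
    (∏ i ∈ Finset.Icc 2 (n + 1), b i) * (E 1 : ℝ) = E (n + 1) := by
  induction n with
  | zero => simp
  | succ n ih =>
    have hE : (E (n + 1) : ℝ) ≠ 0 := (E_pos (n + 1)).ne'
    rw [Finset.prod_Icc_succ_top (by omega), mul_right_comm, ih, b, Nat.add_sub_cancel,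
      mul_div_cancel₀ _ hE]

/-- The summand `k = 1` of `L_j` alone equals `E_j`. -/
lemma E_le_Lb (n : ℕ) : (E (n + 2) : ℝ) ≤ Lb (n + 2) := by
  have h : (∏ i ∈ Finset.Icc (1 + 1) (n + 2), b i) * ell 1 ≤
      ∑ k ∈ Finset.Icc 1 (n + 2 - 1), (∏ i ∈ Finset.Icc (k + 1) (n + 2), b i) * ell k :=
    Finset.single_le_sum
      (f := fun k => (∏ i ∈ Finset.Icc (k + 1) (n + 2), b i) * ell k)
      (fun k _ => mul_nonneg (Finset.prod_nonneg fun i _ => (b_pos i).le) (ell_pos k).le)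
      (Finset.mem_Icc.2 ⟨le_rfl, by omega⟩)
  have hell : ell 1 = E 1 := if_pos rfl
  rw [hell, prod_b_mul_E_one (n + 1)] at h
  have := ell_pos (n + 2)
  unfold Lb
  linarith

lemma ell_div_Lb_le (n : ℕ) :
    ell (n + 2) / Lb (n + 2) ≤ 4 * ((a n : ℝ) / 2 ^ a n) ^ 2 := by
  have hE := E_pos (n + 2)
  have hE' := (E_pos (n + 1)).ne'
  have hell : ell (n + 2) = 4 * (E (n + 2) : ℝ) * E n / E (n + 1) := if_neg (by omega)
  calc ell (n + 2) / Lb (n + 2) ≤ ell (n + 2) / E (n + 2) :=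
        div_le_div_of_nonneg_left (ell_pos _).le hE (E_le_Lb n)
    _ = 4 * ((E n : ℝ) / E (n + 1)) := by
        rw [hell]
        field_simp
    _ = 4 * ((a n : ℝ) / 2 ^ a n) ^ 2 := by
        simp only [E, a, Nat.cast_pow, Nat.cast_ofNat, div_pow]

lemma tendsto_four_mul_a_div_two_pow_sq :
    Filter.Tendsto (fun n => 4 * ((a n : ℝ) / 2 ^ a n) ^ 2) Filter.atTop (nhds 0) := by
  have h : Filter.Tendsto (fun n : ℕ => (n : ℝ) / 2 ^ n) Filter.atTop (nhds 0) := by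
    simpa using tendsto_pow_const_div_const_pow_of_one_lt 1 (one_lt_two (α := ℝ))
  simpa using ((h.comp strictMono_a.tendsto_atTop).pow 2).const_mul 4

/-- For every `j ≥ 2`, `ℓ_j / L_j ≤ 4 (a_{j-2}/2^{a_{j-2}})²`;
in particular `ℓ_j / L_j → 0` as `j → ∞`. -/
theorem ell_div_L_small :
    (∀ j : ℕ, 2 ≤ j →
      ell j / Lb j ≤ 4 * ((a (j - 2) : ℝ) / 2 ^ a (j - 2)) ^ 2) ∧
    Filter.Tendsto (fun j : ℕ => ell j / Lb j) Filter.atTop (nhds 0) := by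
  constructor
  · intro j hj
    obtain ⟨n, rfl⟩ := Nat.exists_eq_add_of_le' hj
    exact ell_div_Lb_le n
  · rw [← Filter.tendsto_add_atTop_iff_nat 2]
    exact squeeze_zero
      (fun n => div_nonneg (ell_pos _).le ((E_pos _).le.trans (E_le_Lb n)))
      ell_div_Lb_le tendsto_four_mul_a_div_two_pow_sq
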